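/- Suppose u₀ is an initial world in a Kripke model N with reflexive and transitive accessibility relation, and suppose that for every regular finite tree T (with its root as initial node) there is a frame labeling of T for (N,u₀). Then every propositional modal formula valid at u₀ (meaning every uniform substitution instance of it is true at u₀ in N) is provable in the modal logic Grz. -/

import Mathlib

namespace GrzPaper

/-- Propositional modal formulas, built from variables, falsum, implication and box. -/
inductive Formula : Type
  | var : ℕ → Formula
  | fls : Formula
  | impl : Formula → Formula → Formula
  | box : Formula → Formula
deriving DecidableEq

namespace Formula

def neg (φ : Formula) : Formula := impl φ fls
def tru : Formula := neg fls
def disj (φ ψ : Formula) : Formula := impl (neg φ) ψ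
def conj (φ ψ : Formula) : Formula := neg (impl φ (neg ψ))
def dia (φ : Formula) : Formula := neg (box (neg φ))

/-- Uniform substitution. -/
def subst (σ : ℕ → Formula) : Formula → Formula
  | var n => σ n
  | fls => fls
  | impl a b => impl (subst σ a) (subst σ b)
  | box a => box (subst σ a)

/-- Propositional (Boolean) evaluation, treating variables and boxed formulas as atoms. -/
def evalProp (v : Formula → Bool) : Formula → Bool
  | var n => v (var n)
  | fls => false
  | impl a b => !(evalProp v a) || evalProp v b
  | box a => v (box a)

/-- A propositional tautology: true under every Boolean valuation of the atoms
(variables and boxed subformulas). -/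
def Tautology (φ : Formula) : Prop := ∀ v, evalProp v φ = true

end Formula

open Formula

/-- A normal modal logic: contains all propositional tautologies and all instances of K,
closed under modus ponens, necessitation and uniform substitution. -/
structure IsNormalLogic (L : Set Formula) : Prop where
  taut : ∀ φ, Tautology φ → φ ∈ L
  axK : ∀ φ ψ, impl (box (impl φ ψ)) (impl (box φ) (box ψ)) ∈ L
  mp : ∀ φ ψ, impl φ ψ ∈ L → φ ∈ L → ψ ∈ L
  nec : ∀ φ, φ ∈ L → box φ ∈ L
  subst : ∀ φ σ, φ ∈ L → φ.subst σ ∈ L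

/-- The normal modal logic generated by a set of axioms: the smallest normal modal
logic containing them. -/
def Generated (Ax : Set Formula) : Set Formula :=
  ⋂₀ {L | IsNormalLogic L ∧ Ax ⊆ L}

def pv : Formula := var 0
def qv : Formula := var 1

def axT : Formula := impl (box pv) pv
def axFour : Formula := impl (box pv) (box (box pv))
def axGrz : Formula := impl (box (impl (box (impl pv (box pv))) pv)) pv
def axPoint2 : Formula := impl (dia (box pv)) (box (dia pv))
def axPoint3 : Formula := disj (box (impl (box pv) qv)) (box (impl (box qv) pv))

/-- penultimate(φ) : φ ∧ ◇¬φ ∧ □(¬φ → □¬φ). -/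
def penultimate (φ : Formula) : Formula :=
  conj φ (conj (dia (neg φ)) (box (impl (neg φ) (box (neg φ)))))

/-- contingent(φ) : ◇φ ∧ ◇¬φ. -/
def contingent (φ : Formula) : Formula := conj (dia φ) (dia (neg φ))

/-- The axiom Grz* : contingent(p) → ◇(penultimate(p) ∨ penultimate(¬p)). -/
def axGrzStar : Formula :=
  impl (contingent pv) (dia (disj (penultimate pv) (penultimate (neg pv))))

def Grz : Set Formula := Generated {axGrz}
def GrzStarLogic : Set Formula := Generated {axGrzStar}
def S4GrzStar : Set Formula := Generated {axT, axFour, axGrzStar}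
def Grz2 : Set Formula := Generated {axGrz, axPoint2}
def Grz3 : Set Formula := Generated {axGrz, axPoint3}
def KLogic : Set Formula := Generated ∅

/-- A Kripke model: an accessibility relation together with a valuation. -/
structure KripkeModel (W : Type) where
  rel : W → W → Prop
  val : ℕ → W → Prop

/-- Satisfaction of a modal formula at a world of a Kripke model. -/
def Satisfies {W : Type} (M : KripkeModel W) : W → Formula → Prop
  | w, .var n => M.val n w
  | _, .fls => False
  | w, .impl a b => Satisfies M w a → Satisfies M w b
  | w, .box a => ∀ v, M.rel w v → Satisfies M v a

/-- Validity of a formula on a Kripke frame. -/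
def ValidOnFrame (W : Type) (R : W → W → Prop) (φ : Formula) : Prop :=
  ∀ (val : ℕ → W → Prop) (w : W), Satisfies ⟨R, val⟩ w φ

/-- A model labeling of (M,w₀) for (N,u₀): a substitution σ such that every formula is
true at (M,w₀) iff its σ-instance is true at (N,u₀). -/
def ModelLabeling {W U : Type} (M : KripkeModel W) (w0 : W) (N : KripkeModel U) (u0 : U)
    (σ : ℕ → Formula) : Prop :=
  ∀ φ : Formula, Satisfies M w0 φ ↔ Satisfies N u0 (φ.subst σ)

/-- A frame labeling of the frame (W,R) with initial node w₀ for the pointed model (N,u₀). -/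
def FrameLabeling {W U : Type} (R : W → W → Prop) (w0 : W) (N : KripkeModel U) (u0 : U)
    (Φ : W → Formula) : Prop :=
  Satisfies N u0 (Φ w0) ∧
  (∀ u, N.rel u0 u → ∀ w, Satisfies N u (Φ w) →
    ∀ w', (Satisfies N u (dia (Φ w')) ↔ R w w')) ∧
  (∀ u, N.rel u0 u → ∃! w, Satisfies N u (Φ w))

def bigOr : List Formula → Formula
  | [] => fls
  | φ :: l => disj φ (bigOr l)

def bigAnd : List Formula → Formula
  | [] => tru
  | φ :: l => conj φ (bigAnd l)

open Classical in
/-- The disjunction ⋁ {Φ w : P w}. -/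
noncomputable def labelFormula {W : Type} [Fintype W] (Φ : W → Formula) (P : W → Prop) :
    Formula :=
  bigOr ((Finset.univ.filter P).toList.map Φ)

/-- Θ_A : the formula asserting that the button pattern is exactly A. -/
noncomputable def Theta {n : ℕ} (b : Fin n → Formula) (A : Finset (Fin n)) : Formula :=
  bigAnd ((Finset.univ : Finset (Fin n)).toList.map
    (fun i => if i ∈ A then box (b i) else neg (box (b i))))

/-- b₀,…,b_{n−1} are independent buttons at u₀: none is pushed (necessary) at u₀, and
necessarily, whenever the button pattern is exactly A, every larger pattern is possible. -/
def IndependentButtons {U : Type} (N : KripkeModel U) (u0 : U) {n : ℕ}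
    (b : Fin n → Formula) : Prop :=
  (∀ i, ¬ Satisfies N u0 (box (b i))) ∧
  ∀ A : Finset (Fin n), ∀ u, N.rel u0 u → Satisfies N u (Theta b A) →
    ∀ A' : Finset (Fin n), A ⊆ A' → Satisfies N u (dia (Theta b A'))

/-- r₀,…,r_{n−1} form a ratchet of length n at u₀. -/
def Ratchet {U : Type} (N : KripkeModel U) (u0 : U) {n : ℕ} (r : Fin n → Formula) : Prop :=
  (∀ i : Fin n, (i.val = 0 → Satisfies N u0 (box (r i))) ∧
      (0 < i.val → ¬ Satisfies N u0 (box (r i)))) ∧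
  (∀ u, N.rel u0 u → ∀ i j : Fin n, i < j →
      Satisfies N u (box (r j)) → Satisfies N u (box (r i))) ∧
  (∀ u, N.rel u0 u → ∀ i : Fin n, 0 < i.val →
      (∀ j : Fin n, Satisfies N u (box (r j)) ↔ j < i) →
        ∃ v, N.rel u v ∧ ∀ j : Fin n, Satisfies N v (box (r j)) ↔ j ≤ i)

/-- A (finite) tree order: a partial order with a least element in which the set of
predecessors of every element is linearly ordered. -/
def IsTreeOrder {W : Type} (R : W → W → Prop) : Prop :=
  IsPartialOrder W R ∧ (∃ r, ∀ x, R r x) ∧ ∀ x a b, R a x → R b x → R a b ∨ R b a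

/-- A baled tree order: a partial order with a greatest element t whose removal
leaves a tree. -/
def IsBaledTreeOrder {W : Type} (R : W → W → Prop) : Prop :=
  IsPartialOrder W R ∧ ∃ t : W, (∀ x, R x t) ∧
    (∃ r, r ≠ t ∧ ∀ x, x ≠ t → R r x) ∧
    (∀ x a b, x ≠ t → R a x → R b x → R a b ∨ R b a)

/-- Height of a node: the number of its strict predecessors. -/
noncomputable def heightOf {W : Type} (R : W → W → Prop) (x : W) : ℕ :=
  Nat.card {y : W // R y x ∧ y ≠ x}

/-- y is an immediate successor of x. -/
def ImmSucc {W : Type} (R : W → W → Prop) (x y : W) : Prop :=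
  R x y ∧ x ≠ y ∧ ∀ z, R x z → R z y → z = x ∨ z = y

def IsMaximal {W : Type} (R : W → W → Prop) (x : W) : Prop := ∀ z, R x z → z = x

/-- A regular finite tree: all maximal elements have the same height, and any two
elements of the same height have the same number of immediate successors. -/
def IsRegularTree {W : Type} (R : W → W → Prop) : Prop :=
  IsTreeOrder R ∧
  (∀ x y, IsMaximal R x → IsMaximal R y → heightOf R x = heightOf R y) ∧
  (∀ x y, heightOf R x = heightOf R y →
    Nat.card {z : W // ImmSucc R x z} = Nat.card {z : W // ImmSucc R y z})


theorem grz_isNormalLogic : IsNormalLogic Grz where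
  taut φ h := by rintro L ⟨hL, -⟩; exact hL.taut φ h
  axK φ ψ := by rintro L ⟨hL, -⟩; exact hL.axK φ ψ
  mp φ ψ h h' := by rintro L ⟨hL, hA⟩; exact hL.mp φ ψ (h L ⟨hL, hA⟩) (h' L ⟨hL, hA⟩)
  nec φ h := by rintro L ⟨hL, hA⟩; exact hL.nec φ (h L ⟨hL, hA⟩)
  subst φ σ h := by rintro L ⟨hL, hA⟩; exact hL.subst φ σ (h L ⟨hL, hA⟩)

theorem grz_axGrz (p : Formula) : impl (box (impl (box (impl p (box p))) p)) p ∈ Grz := by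
  have h : axGrz ∈ Grz := by rintro L ⟨-, hA⟩; exact hA rfl
  exact grz_isNormalLogic.subst _ (fun _ => p) h

theorem grz_box_mono {p q : Formula} (h : impl p q ∈ Grz) : impl (box p) (box q) ∈ Grz :=
  grz_isNormalLogic.mp _ _ (grz_isNormalLogic.axK p q) (grz_isNormalLogic.nec _ h)

/-- A consequence of one theorem of Grz by propositional logic. -/
theorem grz_of_taut {p q : Formula} (h : p ∈ Grz) (ht : Tautology (impl p q)) : q ∈ Grz :=
  grz_isNormalLogic.mp _ _ (grz_isNormalLogic.taut _ ht) h

/-- A consequence of two theorems of Grz by propositional logic. -/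
theorem grz_of_taut₂ {p q r : Formula} (hp : p ∈ Grz) (hq : q ∈ Grz)
    (ht : Tautology (impl p (impl q r))) : r ∈ Grz :=
  grz_isNormalLogic.mp _ _ (grz_of_taut hp ht) hq

theorem grz_axT (p : Formula) : impl (box p) p ∈ Grz := by
  have h : impl (box p) (box (impl (box (impl p (box p))) p)) ∈ Grz := by
    refine grz_box_mono (grz_isNormalLogic.taut _ fun v => ?_)
    simp only [evalProp]; grind
  refine grz_of_taut₂ h (grz_axGrz p) fun v => ?_
  simp only [evalProp]; grind

theorem grz_axFour (p : Formula) : impl (box p) (box (box p)) ∈ Grz := by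
  set q : Formula := conj p (impl (box p) (box (box p))) with hq
  have hqp : impl (box q) (box p) ∈ Grz := by
    refine grz_box_mono (grz_isNormalLogic.taut _ fun v => ?_)
    simp only [hq, conj, neg, evalProp]; grind
  have h₁ : impl p (impl (impl q (box q)) (box p)) ∈ Grz := by
    refine grz_of_taut hqp fun v => ?_
    generalize hb : box q = b
    simp only [hq, conj, neg, evalProp]; grind
  have h₂ : impl (box p) (impl (box (impl q (box q))) (box (box p))) ∈ Grz := by
    refine grz_of_taut₂ (grz_box_mono h₁) (grz_isNormalLogic.axK (impl q (box q)) (box p))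
      fun v => ?_
    simp only [evalProp]; grind
  have h₃ : impl p (impl (box (impl q (box q))) q) ∈ Grz := by
    refine grz_of_taut h₂ fun v => ?_
    generalize box (impl q (box q)) = b
    simp only [hq, conj, neg, evalProp]; grind
  refine grz_of_taut₂ (grz_box_mono h₃) (grz_axGrz q) fun v => ?_
  generalize box (impl (box (impl q (box q))) q) = b
  simp only [hq, conj, neg, evalProp]; grind

/-- Sets of formulas containing Grz and closed under modus ponens. -/
structure IsTheory (S : Set Formula) : Prop where
  grz : ∀ φ, φ ∈ Grz → φ ∈ S
  mp : ∀ φ ψ, impl φ ψ ∈ S → φ ∈ S → ψ ∈ S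

/-- Maximal consistent theories over Grz. -/
structure IsMaximalTheory (S : Set Formula) : Prop extends IsTheory S where
  fls : fls ∉ S
  total : ∀ φ, φ ∈ S ∨ neg φ ∈ S

theorem IsTheory.mp₂ {S : Set Formula} (hS : IsTheory S) {p q r : Formula}
    (h : impl p (impl q r) ∈ Grz) (hp : p ∈ S) (hq : q ∈ S) : r ∈ S :=
  hS.mp _ _ (hS.mp _ _ (hS.grz _ h) hp) hq

theorem IsTheory.of_taut {S : Set Formula} (hS : IsTheory S) {p : Formula} (h : Tautology p) :
    p ∈ S := hS.grz _ (grz_isNormalLogic.taut _ h)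

theorem grz_isTheory : IsTheory Grz := ⟨fun _ h => h, grz_isNormalLogic.mp⟩

theorem IsTheory.adjoin {S : Set Formula} (hS : IsTheory S) (χ : Formula) :
    IsTheory {θ | impl χ θ ∈ S} where
  grz φ h := hS.grz _ (grz_of_taut h fun v => by simp only [evalProp]; grind)
  mp φ ψ h h' := by
    refine hS.mp₂ (p := impl χ (impl φ ψ)) (grz_isNormalLogic.taut _ fun v => ?_) h h'
    simp only [evalProp]; grind

theorem IsTheory.unbox {S : Set Formula} (hS : IsTheory S) : IsTheory {θ | box θ ∈ S} where
  grz _ h := hS.grz _ (grz_isNormalLogic.nec _ h)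
  mp φ ψ h₁ h₂ := hS.mp₂ (grz_isNormalLogic.axK φ ψ) h₁ h₂

/-- Lindenbaum's lemma. -/
theorem IsTheory.exists_maximal {S : Set Formula} (hS : IsTheory S) {ψ : Formula} (hψ : ψ ∉ S) :
    ∃ M, S ⊆ M ∧ IsMaximalTheory M ∧ ψ ∉ M := by
  obtain ⟨M, hSM, hM⟩ := zorn_subset_nonempty {T | IsTheory T ∧ ψ ∉ T} (by
    rintro c hc hchain ⟨T₀, hT₀⟩
    refine ⟨⋃₀ c, ⟨⟨fun φ h => ⟨T₀, hT₀, (hc hT₀).1.grz φ h⟩, ?_⟩, ?_⟩,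
      fun T hT => Set.subset_sUnion_of_mem hT⟩
    · rintro _ _ ⟨A, hA, h⟩ ⟨B, hB, h'⟩
      rcases hchain.total hA hB with hAB | hBA
      · exact ⟨B, hB, (hc hB).1.mp _ _ (hAB h) h'⟩
      · exact ⟨A, hA, (hc hA).1.mp _ _ h (hBA h')⟩
    · rintro ⟨A, hA, h⟩
      exact (hc hA).2 h) S ⟨hS, hψ⟩
  obtain ⟨⟨hT, hψM⟩, hmax⟩ := hM
  have key : ∀ χ, χ ∉ M → impl χ ψ ∈ M := by
    intro χ hχ
    by_contra hn
    refine hχ (hmax (y := {θ | impl χ θ ∈ M}) ⟨hT.adjoin χ, hn⟩ (fun θ hθ => ?_) ?_)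
    · refine hT.mp _ _ (hT.of_taut fun v => ?_) hθ
      simp only [evalProp]; grind
    · refine hT.of_taut fun v => ?_
      simp only [evalProp]; grind
  refine ⟨M, hSM, ⟨hT, fun h => hψM ?_, fun χ => ?_⟩, hψM⟩
  · exact hT.mp _ _ (hT.of_taut fun v => by simp [evalProp]) h
  · by_contra! h
    refine hψM (hT.mp₂ (grz_isNormalLogic.taut _ fun v => ?_) (key _ h.1) (key _ h.2))
    simp only [neg, evalProp]; grind

theorem IsMaximalTheory.impl_mem_iff {S : Set Formula} (hS : IsMaximalTheory S) (p q : Formula) :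
    impl p q ∈ S ↔ (p ∈ S → q ∈ S) := by
  refine ⟨hS.mp p q, fun h => ?_⟩
  rcases hS.total p with hp | hp
  · exact hS.mp _ _ (hS.of_taut fun v => by simp only [evalProp]; grind) (h hp)
  · exact hS.mp _ _ (hS.of_taut fun v => by simp only [neg, evalProp]; grind) hp

theorem IsTheory.mem_of_box_mem {S : Set Formula} (hS : IsTheory S) {p : Formula}
    (h : box p ∈ S) : p ∈ S := hS.mp _ _ (hS.grz _ (grz_axT p)) h

/-- A formula that is not necessary fails in an accessible maximal theory from which
its truth persists. -/
theorem IsMaximalTheory.exists_succ {S : Set Formula} (hS : IsMaximalTheory S) {ψ : Formula}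
    (hψ : box ψ ∉ S) :
    ∃ M, IsMaximalTheory M ∧ (∀ χ, box χ ∈ S → box χ ∈ M) ∧ ψ ∉ M ∧
      box (impl ψ (box ψ)) ∈ M := by
  have hT := hS.unbox.adjoin (box (impl ψ (box ψ)))
  obtain ⟨M, hSM, hM, hψM⟩ := hT.exists_maximal (ψ := ψ) fun h => hψ <| by
    have h₄ := hS.mp _ _ (hS.grz _ (grz_axFour _)) h
    exact hS.mp _ _ (hS.grz _ (grz_box_mono (grz_axGrz ψ))) h₄
  refine ⟨M, hM, fun χ hχ => hSM ?_, hψM, hSM ?_⟩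
  · have h₄ := hS.mp _ _ (hS.grz _ (grz_axFour _)) hχ
    refine hS.mp _ _ (hS.grz _ (grz_box_mono (grz_isNormalLogic.taut _ fun v => ?_))) h₄
    simp only [evalProp]; grind
  · refine hS.grz _ (grz_isNormalLogic.nec _ (grz_isNormalLogic.taut _ fun v => ?_))
    simp only [evalProp]; grind

/-- `ψ` is true but not necessary in `S`. -/
def IsDefect (S : Set Formula) (ψ : Formula) : Prop := ψ ∈ S ∧ box ψ ∉ S

open Classical in
/-- The number of formulas in `T` whose truth need not persist according to `S`. -/
noncomputable def defectRank (T : Finset Formula) (S : Set Formula) : ℕ :=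
  (T.filter fun ψ => box (impl ψ (box ψ)) ∉ S).card

theorem IsMaximalTheory.exists_succ_rank_lt {T : Finset Formula} {S : Set Formula}
    (hS : IsMaximalTheory S) {ψ : Formula} (hψT : ψ ∈ T) (hψ : IsDefect S ψ) :
    ∃ M, IsMaximalTheory M ∧ (∀ χ, box χ ∈ S → box χ ∈ M) ∧ ψ ∉ M ∧
      defectRank T M < defectRank T S := by
  classical
  obtain ⟨M, hM, hbox, hψM, hM'⟩ := hS.exists_succ hψ.2
  refine ⟨M, hM, hbox, hψM, Finset.card_lt_card ?_⟩
  refine Finset.ssubset_iff_of_subset (fun χ hχ => ?_) |>.2 ⟨ψ, ?_, ?_⟩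
  · rw [Finset.mem_filter] at hχ ⊢
    exact ⟨hχ.1, fun h => hχ.2 (hbox _ h)⟩
  · rw [Finset.mem_filter]
    exact ⟨hψT, fun h => hψ.2 (hS.mp _ _ (hS.mem_of_box_mem h) hψ.1)⟩
  · simp [hM']

theorem IsMaximalTheory.not_isDefect_of_rank_eq_zero {T : Finset Formula} {S : Set Formula}
    (hS : IsMaximalTheory S) (h : defectRank T S = 0) {ψ : Formula} (hψT : ψ ∈ T) :
    ¬ IsDefect S ψ := fun hψ => by
  obtain ⟨M, -, -, -, hlt⟩ := hS.exists_succ_rank_lt hψT hψ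
  omega

/-- `M` is accessible from `S`, it refutes `ψ` if `ψ` is a defect of `S`, and it has smaller
rank than `S`, unless `S` has no defects in `T`, in which case it is `S` itself. -/
def IsChild (T : Finset Formula) (S : {S // IsMaximalTheory S}) (ψ : Formula)
    (M : {S // IsMaximalTheory S}) : Prop :=
  (∀ χ, box χ ∈ S.1 → box χ ∈ M.1) ∧ (IsDefect S.1 ψ → ψ ∉ M.1) ∧
  ((∀ χ ∈ T, ¬ IsDefect S.1 χ) → M = S) ∧
  ((∃ χ ∈ T, IsDefect S.1 χ) → defectRank T M.1 < defectRank T S.1)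

theorem exists_isChild (T : Finset Formula) (S : {S // IsMaximalTheory S}) (i : T) :
    ∃ M, IsChild T S i M := by
  by_cases hi : IsDefect S.1 i
  · obtain ⟨M, hM, hbox, hiM, hlt⟩ := S.2.exists_succ_rank_lt i.2 hi
    exact ⟨⟨M, hM⟩, hbox, fun _ => hiM, fun h => absurd hi (h i i.2), fun _ => hlt⟩
  by_cases hd : ∃ ψ ∈ T, IsDefect S.1 ψ
  · obtain ⟨ψ, hψT, hψ⟩ := hd
    obtain ⟨M, hM, hbox, -, hlt⟩ := S.2.exists_succ_rank_lt hψT hψ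
    exact ⟨⟨M, hM⟩, hbox, fun h => absurd h hi, fun h => absurd hψ (h ψ hψT), fun _ => hlt⟩
  · exact ⟨S, fun _ h => h, fun h => absurd h hi, fun _ => rfl, fun h => absurd h hd⟩

/-- The maximal theories attached to the nodes of the tree of finite sequences from `T`. -/
noncomputable def treeTheory (T : Finset Formula) (S : {S // IsMaximalTheory S}) :
    List T → {S // IsMaximalTheory S}
  | [] => S
  | i :: l => (exists_isChild T (treeTheory T S l) i).choose

theorem treeTheory_cons_spec (T : Finset Formula) (S : {S // IsMaximalTheory S}) (l : List T)
    (i : T) : IsChild T (treeTheory T S l) i (treeTheory T S (i :: l)) :=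
  (exists_isChild T (treeTheory T S l) i).choose_spec

theorem treeTheory_box_mono (T : Finset Formula) (S : {S // IsMaximalTheory S}) {l l' : List T}
    (h : l <:+ l') {χ : Formula} (hχ : box χ ∈ (treeTheory T S l).1) :
    box χ ∈ (treeTheory T S l').1 := by
  obtain ⟨m, rfl⟩ := h
  induction m with
  | nil => exact hχ
  | cons i m ih => exact (treeTheory_cons_spec T S (m ++ l) i).1 χ ih

theorem treeTheory_rank (T : Finset Formula) (S : {S // IsMaximalTheory S}) (l : List T) :
    (∀ ψ ∈ T, ¬ IsDefect (treeTheory T S l).1 ψ) ∨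
      defectRank T (treeTheory T S l).1 + l.length ≤ T.card := by
  induction l with
  | nil => classical exact Or.inr (Finset.card_filter_le _ _)
  | cons i l ih =>
    obtain ⟨-, -, h₁, h₂⟩ := treeTheory_cons_spec T S l i
    by_cases hd : ∀ ψ ∈ T, ¬ IsDefect (treeTheory T S l).1 ψ
    · left; rwa [h₁ hd]
    · right
      have hlt := h₂ (by push Not at hd; exact hd)
      have hle := ih.resolve_left hd
      simp only [List.length_cons]; omega

theorem treeTheory_not_isDefect (T : Finset Formula) (S : {S // IsMaximalTheory S}) {l : List T}
    (hl : T.card ≤ l.length) {ψ : Formula} (hψ : ψ ∈ T) :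
    ¬ IsDefect (treeTheory T S l).1 ψ := by
  rcases treeTheory_rank T S l with h | h
  · exact h ψ hψ
  · exact (treeTheory T S l).2.not_isDefect_of_rank_eq_zero (T := T) (by omega) hψ

/-- The finite tree of all sequences from `ι` of length at most `n`. -/
abbrev SeqTree (ι : Type) (n : ℕ) : Type := {l : List ι // l.length ≤ n}

/-- The tree order on sequences; sequences grow to the left. -/
def SeqTree.le {ι : Type} {n : ℕ} (a b : SeqTree ι n) : Prop := a.1 <:+ b.1

namespace SeqTree

variable {ι : Type} {n : ℕ}

theorem isTreeOrder : IsTreeOrder (le : SeqTree ι n → SeqTree ι n → Prop) := by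
  refine ⟨?_, ⟨⟨[], n.zero_le⟩, fun x => List.nil_suffix⟩, fun x a b ha hb => ?_⟩
  · exact
      { refl := fun a => List.suffix_refl _
        trans := fun a b c h h' => List.IsSuffix.trans h h'
        antisymm := fun a b h h' => Subtype.ext (h.eq_of_length_le h'.length_le) }
  · exact List.suffix_or_suffix_of_suffix ha hb

theorem heightOf_eq (x : SeqTree ι n) : heightOf le x = x.1.length := by
  rw [heightOf, ← Nat.card_fin x.1.length]
  have hlt : ∀ y : {y : SeqTree ι n // le y x ∧ y ≠ x}, y.1.1.length < x.1.length := fun y =>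
    lt_of_le_of_ne y.2.1.length_le fun h => y.2.2 (Subtype.ext (y.2.1.eq_of_length h))
  refine Nat.card_congr (Equiv.ofBijective (fun y => ⟨y.1.1.length, hlt y⟩) ⟨?_, ?_⟩)
  · intro y z h
    have h' : y.1.1.length = z.1.1.length := congrArg Fin.val h
    exact Subtype.ext (Subtype.ext
      ((List.suffix_of_suffix_length_le y.2.1 z.2.1 h'.le).eq_of_length h'))
  · intro i
    have hlen : (x.1.drop (x.1.length - i)).length = i := by
      rw [List.length_drop]; omega
    refine ⟨⟨⟨x.1.drop (x.1.length - i), by have := x.2; omega⟩, List.drop_suffix _ _, ?_⟩, ?_⟩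
    · intro h
      have := congrArg (fun z : SeqTree ι n => z.1.length) h
      simp only [hlen] at this
      omega
    · exact Fin.ext hlen

theorem immSucc_iff {x y : SeqTree ι n} : ImmSucc le x y ↔ ∃ i, y.1 = i :: x.1 := by
  constructor
  · rintro ⟨⟨m, hm⟩, hne, h⟩
    rcases List.eq_nil_or_concat m with rfl | ⟨m, i, rfl⟩
    · exact absurd (Subtype.ext hm) hne
    · have hm' : m ++ i :: x.1 = y.1 := by simpa using hm
      have hle : (i :: x.1).length ≤ n :=
        (List.IsSuffix.length_le ⟨m, hm'⟩).trans y.2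
      rcases h ⟨i :: x.1, hle⟩ (List.suffix_cons _ _) ⟨m, hm'⟩ with h | h
      · simpa using congrArg (fun z : SeqTree ι n => z.1.length) h
      · exact ⟨i, congrArg Subtype.val h.symm⟩
  · rintro ⟨i, hi⟩
    refine ⟨⟨[i], hi.symm⟩, fun h => ?_, fun z hxz hzy => ?_⟩
    · simpa [hi] using congrArg (fun z : SeqTree ι n => z.1.length) h
    · unfold le at hxz hzy
      rw [hi, List.suffix_cons_iff] at hzy
      rcases hzy with h | h
      · exact Or.inr (Subtype.ext (h.trans hi.symm))
      · exact Or.inl (Subtype.ext (h.eq_of_length_le hxz.length_le))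

theorem card_immSucc {x : SeqTree ι n} (hx : x.1.length < n) :
    Nat.card {z : SeqTree ι n // ImmSucc le x z} = Nat.card ι := by
  refine (Nat.card_congr (Equiv.ofBijective
    (fun i => ⟨⟨i :: x.1, hx⟩, immSucc_iff.2 ⟨i, rfl⟩⟩) ⟨fun i j h => ?_, fun z => ?_⟩)).symm
  · simpa using h
  · obtain ⟨i, hi⟩ := immSucc_iff.1 z.2
    exact ⟨i, Subtype.ext (Subtype.ext hi.symm)⟩

theorem card_immSucc_top {x : SeqTree ι n} (hx : ¬ x.1.length < n) :
    Nat.card {z : SeqTree ι n // ImmSucc le x z} = 0 := by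
  have : IsEmpty {z : SeqTree ι n // ImmSucc le x z} := ⟨fun z => by
    obtain ⟨i, hi⟩ := immSucc_iff.1 z.2
    have := z.1.2
    rw [hi, List.length_cons] at this
    omega⟩
  exact Nat.card_of_isEmpty

theorem length_of_isMaximal [Nonempty ι] {x : SeqTree ι n} (hx : IsMaximal le x) :
    x.1.length = n := by
  by_contra hne
  have hlt : x.1.length < n := lt_of_le_of_ne x.2 hne
  have h := hx ⟨Classical.arbitrary ι :: x.1, hlt⟩ (List.suffix_cons _ _)
  simpa using congrArg (fun z : SeqTree ι n => z.1.length) h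

theorem isRegularTree [Nonempty ι] : IsRegularTree (le : SeqTree ι n → SeqTree ι n → Prop) := by
  refine ⟨isTreeOrder, fun x y hx hy => ?_, fun x y h => ?_⟩
  · rw [heightOf_eq, heightOf_eq, length_of_isMaximal hx, length_of_isMaximal hy]
  · rw [heightOf_eq, heightOf_eq] at h
    by_cases hx : x.1.length < n
    · rw [card_immSucc hx, card_immSucc (h ▸ hx)]
    · rw [card_immSucc_top hx, card_immSucc_top (h ▸ hx)]

instance finite [Finite ι] : Finite (SeqTree ι n) := (List.finite_length_le ι n).to_subtype

end SeqTree

/-- The set of subformulas. -/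
def subformulas : Formula → Finset Formula
  | var n => {var n}
  | fls => {fls}
  | impl a b => insert (impl a b) (subformulas a ∪ subformulas b)
  | box a => insert (box a) (subformulas a)

theorem self_mem_subformulas (φ : Formula) : φ ∈ subformulas φ := by
  cases φ <;> simp [subformulas]

/-- The model on the tree of sequences from `T` induced by the attached theories. -/
noncomputable def treeModel (T : Finset Formula) (S : {S // IsMaximalTheory S}) :
    KripkeModel (SeqTree T T.card) :=
  ⟨SeqTree.le, fun n x => var n ∈ (treeTheory T S x.1).1⟩

theorem satisfies_treeModel_iff (T : Finset Formula) (S : {S // IsMaximalTheory S})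
    (χ : Formula) (hχ : subformulas χ ⊆ T) (x : SeqTree T T.card) :
    Satisfies (treeModel T S) x χ ↔ χ ∈ (treeTheory T S x.1).1 := by
  induction χ generalizing x with
  | var n => rfl
  | fls => exact iff_of_false id (treeTheory T S x.1).2.fls
  | impl a b iha ihb =>
    simp only [subformulas, Finset.insert_subset_iff, Finset.union_subset_iff] at hχ
    rw [(treeTheory T S x.1).2.impl_mem_iff, ← iha hχ.2.1, ← ihb hχ.2.2]
    rfl
  | box a ih =>
    simp only [subformulas, Finset.insert_subset_iff] at hχ
    have haT : a ∈ T := hχ.2 (self_mem_subformulas a)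
    constructor
    · intro h
      have ha := (ih hχ.2 x).1 (h x (List.suffix_refl _))
      by_contra hbox
      have hd : IsDefect (treeTheory T S x.1).1 a := ⟨ha, hbox⟩
      have hlt : x.1.length < T.card := by
        by_contra hle
        exact treeTheory_not_isDefect T S (not_lt.1 hle) haT hd
      exact (treeTheory_cons_spec T S x.1 ⟨a, haT⟩).2.1 hd
        ((ih hχ.2 ⟨⟨a, haT⟩ :: x.1, hlt⟩).1 (h _ (List.suffix_cons _ _)))
    · intro h y hxy
      exact (ih hχ.2 y).2
        ((treeTheory T S y.1).2.mem_of_box_mem (treeTheory_box_mono T S hxy h))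

/-- Every nontheorem of Grz fails at the root of a model on a regular finite tree. -/
theorem exists_regular_tree_countermodel {φ : Formula} (hφ : φ ∉ Grz) :
    ∃ (W : Type) (M : KripkeModel W) (w₀ : W), Finite W ∧ IsRegularTree M.rel ∧
      (∀ x, M.rel w₀ x) ∧ ¬ Satisfies M w₀ φ := by
  obtain ⟨S, -, hS, hφS⟩ := grz_isTheory.exists_maximal hφ
  have : Nonempty (subformulas φ) := ⟨⟨φ, self_mem_subformulas φ⟩⟩
  refine ⟨_, treeModel (subformulas φ) ⟨S, hS⟩, ⟨[], Nat.zero_le _⟩, inferInstance,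
    SeqTree.isRegularTree, fun x => List.nil_suffix, ?_⟩
  rwa [satisfies_treeModel_iff _ _ φ subset_rfl]

theorem satisfies_bigOr_iff {U : Type} (N : KripkeModel U) (u : U) (l : List Formula) :
    Satisfies N u (bigOr l) ↔ ∃ φ ∈ l, Satisfies N u φ := by
  induction l with
  | nil => simp [bigOr, Satisfies]
  | cons φ l ih =>
    simp only [bigOr, disj, neg, Satisfies, ih, List.mem_cons, exists_eq_or_imp]
    tauto

theorem satisfies_labelFormula_iff {U W : Type} [Fintype W] (N : KripkeModel U) (u : U)
    (Φ : W → Formula) (P : W → Prop) :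
    Satisfies N u (labelFormula Φ P) ↔ ∃ w, P w ∧ Satisfies N u (Φ w) := by
  simp [labelFormula, satisfies_bigOr_iff]

theorem satisfies_dia_iff {U : Type} (N : KripkeModel U) (u : U) (φ : Formula) :
    Satisfies N u (dia φ) ↔ ∃ v, N.rel u v ∧ Satisfies N v φ := by
  simp [dia, neg, Satisfies]

/-- A frame labeling induces, for every model on the frame, a model labeling. -/
theorem FrameLabeling.modelLabeling {U W : Type} [Fintype W] {N : KripkeModel U} {u0 : U}
    (htrans : Transitive N.rel) (hrefl : Reflexive N.rel) (M : KripkeModel W) {w0 : W}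
    {Φ : W → Formula} (h : FrameLabeling M.rel w0 N u0 Φ) :
    ModelLabeling M w0 N u0 fun n => labelFormula Φ (M.val n) := by
  obtain ⟨h₀, hdia, huniq⟩ := h
  suffices H : ∀ φ u w, N.rel u0 u → Satisfies N u (Φ w) →
      (Satisfies M w φ ↔ Satisfies N u (φ.subst fun n => labelFormula Φ (M.val n))) from
    fun φ => H φ u0 w0 (hrefl u0) h₀
  intro φ
  induction φ with
  | var n =>
    intro u w hu hw
    simp only [Formula.subst, satisfies_labelFormula_iff]
    exact ⟨fun h => ⟨w, h, hw⟩, fun ⟨w', h, hw'⟩ => (huniq u hu).unique hw' hw ▸ h⟩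
  | fls => exact fun _ _ _ _ => Iff.rfl
  | impl a b iha ihb => exact fun u w hu hw => imp_congr (iha u w hu hw) (ihb u w hu hw)
  | box a ih =>
    intro u w hu hw
    constructor
    · intro h v huv
      have hv := htrans hu huv
      obtain ⟨w', hw', -⟩ := huniq v hv
      exact (ih v w' hv hw').1
        (h w' ((hdia u hu w hw w').1 ((satisfies_dia_iff _ _ _).2 ⟨v, huv, hw'⟩)))
    · intro h w' hww'
      obtain ⟨v, huv, hw'⟩ := (satisfies_dia_iff _ _ _).1 ((hdia u hu w hw w').2 hww')
      exact (ih v w' (htrans hu huv) hw').2 (h v huv)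

/-- If u₀ is an initial world of a reflexive transitive Kripke model N that
admits a frame labeling of every regular finite tree (with its root as initial node), then
every formula valid at u₀ is provable in Grz. -/
theorem statement11 {U : Type} (N : KripkeModel U) (u0 : U)
    (hrefl : Reflexive N.rel) (htrans : Transitive N.rel) (hinit : ∀ u, N.rel u0 u)
    (hlab : ∀ (W : Type) (R : W → W → Prop) (w0 : W), Finite W → IsRegularTree R →
        (∀ x, R w0 x) → ∃ Φ : W → Formula, FrameLabeling R w0 N u0 Φ) :
    ∀ φ : Formula, (∀ σ : ℕ → Formula, Satisfies N u0 (φ.subst σ)) → φ ∈ Grz := by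
  intro φ hφ
  by_contra hn
  obtain ⟨W, M, w₀, hfin, hreg, hroot, hfail⟩ := exists_regular_tree_countermodel hn
  obtain ⟨Φ, hΦ⟩ := hlab W M.rel w₀ hfin hreg hroot
  have := Fintype.ofFinite W
  exact hfail ((hΦ.modelLabeling htrans hrefl M φ).2 (hφ _))

end GrzPaper
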